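/- arXiv:2004.09595 — 2 statements merged into one kernel-verified Lean document; each statement's English description precedes it below -/
import Mathlib

section
/- Let (X, μ) be a measure space, Z a real normed vector space, Z_ad ⊆ Z a nonempty set, S : Z → L²(μ) a map, J : Z → ℝ a function, μ̂ ∈ L²(μ) with μ̂ ≥ 0 a.e., and γ ≥ 1. Define the Moreau–Yosida regularized functional J^γ(z) := J(z) + (1/(2γ))‖(μ̂ + γ·Sz)₊‖²_{L²(μ)}. Assume z̄ ∈ Z_ad satisfies S z̄ ≤ 0 a.e., and z̄^γ ∈ Z_ad is a minimizer of J^γ over Z_ad. Then J(z̄^γ) ≤ J^γ(z̄^γ) ≤ J^γ(z̄) ≤ J(z̄) + (1/(2γ))‖μ̂‖²_{L²(μ)} ≤ J(z̄) + (1/2)‖μ̂‖²_{L²(μ)}. -/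
open MeasureTheory

/-- Adding a nonpositive element to a nonnegative one and taking the positive part does not
increase the `Lp` norm. -/
theorem norm_posPart_add_le_norm {X : Type*} [MeasurableSpace X] {μ : Measure X}
    {p : ENNReal} {f g : Lp ℝ p μ} (hf : 0 ≤ f) (hg : g ≤ 0) :
    ‖Lp.posPart (f + g)‖ ≤ ‖f‖ := by
  refine Lp.norm_le_norm_of_ae_le ?_
  filter_upwards [Lp.coeFn_posPart (f + g), Lp.coeFn_add f g, (Lp.coeFn_nonneg f).2 hf,
    (Lp.coeFn_le g 0).2 hg, Lp.coeFn_zero ℝ p μ] with x hpos hadd hfx hgx hzero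
  rw [hzero] at hgx
  simp only [Pi.zero_apply] at hfx hgx
  rw [hpos, hadd, Pi.add_apply, Real.norm_of_nonneg (le_max_right _ _), Real.norm_of_nonneg hfx]
  exact max_le (by linarith) hfx

/-- Basic chain of inequalities for the Moreau–Yosida regularized functional
`J^γ(z) = J(z) + (1/(2γ))‖(μ̂ + γ Sz)₊‖²`: if `z̄ ∈ Z_ad` is feasible (`S z̄ ≤ 0` a.e.)
and `z̄^γ` minimizes `J^γ` over `Z_ad`, then
`J(z̄^γ) ≤ J^γ(z̄^γ) ≤ J^γ(z̄) ≤ J(z̄) + (1/(2γ))‖μ̂‖² ≤ J(z̄) + (1/2)‖μ̂‖²`. -/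
theorem moreau_yosida_chain
    {X : Type*} [MeasurableSpace X] (μ : Measure X)
    {Z : Type*} [NormedAddCommGroup Z] [NormedSpace ℝ Z]
    (Zad : Set Z) (hZad : Zad.Nonempty)
    (S : Z → Lp ℝ 2 μ) (J : Z → ℝ)
    (μhat : Lp ℝ 2 μ) (hμhat : 0 ≤ μhat)
    (γ : ℝ) (hγ : 1 ≤ γ)
    (Jγ : Z → ℝ)
    (hJγ : ∀ z, Jγ z = J z + (1 / (2 * γ)) * ‖Lp.posPart (μhat + γ • S z)‖ ^ 2)
    (zbar : Z) (hzbar : zbar ∈ Zad) (hfeas : S zbar ≤ 0)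
    (zγ : Z) (hzγ : zγ ∈ Zad) (hmin : ∀ z ∈ Zad, Jγ zγ ≤ Jγ z) :
    J zγ ≤ Jγ zγ ∧ Jγ zγ ≤ Jγ zbar ∧
      Jγ zbar ≤ J zbar + (1 / (2 * γ)) * ‖μhat‖ ^ 2 ∧
      J zbar + (1 / (2 * γ)) * ‖μhat‖ ^ 2 ≤ J zbar + (1 / 2) * ‖μhat‖ ^ 2 := by
  have hγ0 : 0 < γ := by linarith
  have hsmul : γ • S zbar ≤ 0 := by
    rw [← Lp.coeFn_le]
    filter_upwards [Lp.coeFn_smul γ (S zbar), (Lp.coeFn_le (S zbar) 0).2 hfeas,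
      Lp.coeFn_zero ℝ 2 μ] with x hx hSx hzero
    rw [hzero] at hSx ⊢
    rw [hx]
    exact mul_nonpos_of_nonneg_of_nonpos hγ0.le hSx
  refine ⟨?_, hmin zbar hzbar, ?_, ?_⟩
  · rw [hJγ]
    exact le_add_of_nonneg_right (by positivity)
  · rw [hJγ]
    gcongr
    exact norm_posPart_add_le_norm hμhat hsmul
  · gcongr
    linarith
end

section
/- Let (X, μ) be a measure space, Z a real normed vector space, Z_ad ⊆ Z a nonempty set, S : Z → L²(μ) a map, J : Z → ℝ a function, μ̂ ∈ L²(μ) with μ̂ ≥ 0 a.e., and γ > 0. Define J^γ(z) := J(z) + (1/(2γ))‖(μ̂ + γ·Sz)₊‖²_{L²(μ)}. Assume z̄ ∈ Z_ad satisfies S z̄ ≤ 0 a.e., and z̄^γ ∈ Z_ad is a minimizer of J^γ over Z_ad. Then ‖(S z̄^γ)₊‖²_{L²(μ)} ≤ (2/γ)·( J(z̄) − J(z̄^γ) + (1/(2γ))‖μ̂‖²_{L²(μ)} ); in particular ‖(S z̄^γ)₊‖_{L²(μ)} ≤ ω·γ^{−1/2}, where ω := 2·max( (1/(2γ))‖μ̂‖²_{L²(μ)},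 (J(z̄) − J(z̄^γ))₊ )^{1/2}. -/
open MeasureTheory

/-- Adding a nonnegative function only increases the positive part, and the positive part is
positively homogeneous. -/
lemma mul_norm_posPart_le_norm_posPart_add_smul {X : Type*} [MeasurableSpace X] {μ : Measure X}
    {p : ENNReal} [Fact (1 ≤ p)] {f : Lp ℝ p μ} (hf : 0 ≤ f) {c : ℝ} (hc : 0 ≤ c) (g : Lp ℝ p μ) :
    c * ‖Lp.posPart g‖ ≤ ‖Lp.posPart (f + c • g)‖ := by
  have hnorm : ‖c • Lp.posPart g‖ = c * ‖Lp.posPart g‖ := by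
    rw [norm_smul, Real.norm_of_nonneg hc]
  rw [← hnorm]
  apply Lp.norm_le_norm_of_ae_le
  filter_upwards [Lp.coeFn_posPart g, Lp.coeFn_posPart (f + c • g), Lp.coeFn_smul c g,
    Lp.coeFn_smul c (Lp.posPart g), Lp.coeFn_add f (c • g), (Lp.coeFn_nonneg f).2 hf]
    with x hg hfg hcg hcpos hadd hfx
  simp only [Pi.zero_apply, Pi.add_apply, Pi.smul_apply, smul_eq_mul] at *
  rw [hcpos, hfg, hg, hadd, hcg, Real.norm_of_nonneg (by positivity),
    Real.norm_of_nonneg (le_max_right _ _), mul_max_of_nonneg _ _ hc, mul_zero]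
  exact max_le_max_right 0 (by linarith)

/-- Adding a nonnegative multiple of a nonpositive function to a nonnegative one does not
increase the norm of the positive part. -/
lemma norm_posPart_add_smul_le {X : Type*} [MeasurableSpace X] {μ : Measure X}
    {p : ENNReal} {f g : Lp ℝ p μ} (hf : 0 ≤ f) (hg : g ≤ 0) {c : ℝ} (hc : 0 ≤ c) :
    ‖Lp.posPart (f + c • g)‖ ≤ ‖f‖ := by
  apply Lp.norm_le_norm_of_ae_le
  filter_upwards [Lp.coeFn_posPart (f + c • g), Lp.coeFn_smul c g, Lp.coeFn_add f (c • g),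
    (Lp.coeFn_nonneg f).2 hf, (Lp.coeFn_le g 0).2 hg, Lp.coeFn_zero ℝ p μ]
    with x hfg hcg hadd hfx hgx hzero
  simp only [Pi.zero_apply, Pi.add_apply, Pi.smul_apply, smul_eq_mul] at *
  rw [hzero] at hgx
  rw [hfg, hadd, hcg, Real.norm_of_nonneg (le_max_right _ _), Real.norm_of_nonneg hfx]
  exact max_le (by nlinarith) hfx

/-- Bound on the state-constraint violation of the Moreau–Yosida regularized solution:
`‖(S z̄^γ)₊‖² ≤ (2/γ)(J(z̄) − J(z̄^γ) + (1/(2γ))‖μ̂‖²)`, and in particular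
`‖(S z̄^γ)₊‖ ≤ ω · γ^{−1/2}` with
`ω = 2 max((1/(2γ))‖μ̂‖², (J(z̄) − J(z̄^γ))₊)^{1/2}`. -/
theorem moreau_yosida_violation_bound
    {X : Type*} [MeasurableSpace X] (μ : Measure X)
    {Z : Type*} [NormedAddCommGroup Z] [NormedSpace ℝ Z]
    (Zad : Set Z) (hZad : Zad.Nonempty)
    (S : Z → Lp ℝ 2 μ) (J : Z → ℝ)
    (μhat : Lp ℝ 2 μ) (hμhat : 0 ≤ μhat)
    (γ : ℝ) (hγ : 0 < γ)
    (Jγ : Z → ℝ)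
    (hJγ : ∀ z, Jγ z = J z + (1 / (2 * γ)) * ‖Lp.posPart (μhat + γ • S z)‖ ^ 2)
    (zbar : Z) (hzbar : zbar ∈ Zad) (hfeas : S zbar ≤ 0)
    (zγ : Z) (hzγ : zγ ∈ Zad) (hmin : ∀ z ∈ Zad, Jγ zγ ≤ Jγ z) :
    ‖Lp.posPart (S zγ)‖ ^ 2 ≤
        (2 / γ) * (J zbar - J zγ + (1 / (2 * γ)) * ‖μhat‖ ^ 2) ∧
      ‖Lp.posPart (S zγ)‖ ≤
        (2 * Real.sqrt (max ((1 / (2 * γ)) * ‖μhat‖ ^ 2) (max (J zbar - J zγ) 0))) *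
          γ ^ (-(1 / 2 : ℝ)) := by
  have hlower := mul_norm_posPart_le_norm_posPart_add_smul hμhat hγ.le (S zγ)
  have hupper := norm_posPart_add_smul_le hμhat hfeas hγ.le
  have hle := hmin zbar hzbar
  rw [hJγ, hJγ] at hle
  set v := ‖Lp.posPart (S zγ)‖
  set m := (1 / (2 * γ)) * ‖μhat‖ ^ 2
  have hv0 : 0 ≤ v := norm_nonneg _
  have hlower' : (1 / (2 * γ)) * (γ * v) ^ 2 ≤
      (1 / (2 * γ)) * ‖Lp.posPart (μhat + γ • S zγ)‖ ^ 2 := by gcongr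
  have hupper' : (1 / (2 * γ)) * ‖Lp.posPart (μhat + γ • S zbar)‖ ^ 2 ≤ m := by
    simp only [m]
    gcongr
  have hsq : v ^ 2 = (2 / γ) * ((1 / (2 * γ)) * (γ * v) ^ 2) := by field_simp
  have hbound : v ^ 2 ≤ (2 / γ) * (J zbar - J zγ + m) := by
    rw [hsq]
    gcongr
    linarith
  refine ⟨hbound, ?_⟩
  set M := max m (max (J zbar - J zγ) 0)
  have hm : m ≤ M := le_max_left _ _
  have hJ : J zbar - J zγ ≤ M := (le_max_left _ _).trans (le_max_right _ _)
  have hM : 0 ≤ M := (le_max_right _ _).trans (le_max_right _ _)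
  rw [Real.rpow_neg hγ.le, ← Real.sqrt_eq_rpow]
  refine (sq_le_sq₀ hv0 (by positivity)).1 ?_
  calc v ^ 2 ≤ (2 / γ) * (J zbar - J zγ + m) := hbound
    _ ≤ (2 / γ) * (M + M) := by gcongr
    _ = (2 * √M * (√γ)⁻¹) ^ 2 := by
      rw [mul_pow, mul_pow, inv_pow, Real.sq_sqrt hM, Real.sq_sqrt hγ.le]
      ring
end
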